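/- arXiv:1408.2635 — 2 statements merged into one kernel-verified Lean document; each statement's English description precedes it below -/
import Mathlib

section
/- Moving Lemma: Let A be a commutative Noetherian ring, J an ideal of A, f ∈ A, and P a finitely generated projective A-module of constant rank n with n ≥ dim(A/J) + 1. Let Δ : P → A be an A-linear map such that Δ(P) ⊆ J and Δ(P) + J²f = J (i.e., Δ induces a surjection P ↠ J/(J²f)). Then for every ideal K ⊆ A with dim(A/K) ≤ n − 1 there exists an A-linear map Θ : P → A with Θ(p) − Δ(p) ∈ J²f for all p ∈ P such that, writing J'' = Θ(P): (i) J'' + (J² ∩ K)f = J; (ii) J'' = J ∩ J' for some ideal J' of A with ht J' ≥ n; and (iii) J' + (J² ∩ K)f = A. -/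
/-- The height of an ideal: the infimum of the heights of the primes containing it
(`⊤` if there are none, e.g. for the unit ideal). -/
noncomputable def idealHeight {A : Type*} [CommRing A] (I : Ideal A) : ℕ∞ :=
  ⨅ (p : PrimeSpectrum A) (_ : I ≤ p.asIdeal), Order.height p

open Module in
/-- evaluation of functionals at the residue field of `q` -/
noncomputable def evAt {A : Type*} [CommRing A] {P : Type*} [AddCommGroup P] [Module A P]
    (q : PrimeSpectrum A) : Module.Dual A P →ₗ[A] (P → q.asIdeal.ResidueField) where
  toFun φ := fun y => algebraMap A _ (φ y)
  map_add' φ ψ := by ext y; simp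
  map_smul' a φ := by ext y; simp [Algebra.smul_def]

theorem evAt_apply {A : Type*} [CommRing A] {P : Type*} [AddCommGroup P] [Module A P]
    (q : PrimeSpectrum A) (φ : Module.Dual A P) (y : P) :
    evAt q φ y = algebraMap A q.asIdeal.ResidueField (φ y) := rfl

/-- fibre span -/
noncomputable def fsp {A : Type*} [CommRing A] {P : Type*} [AddCommGroup P] [Module A P]
    (q : PrimeSpectrum A) (S : Set (Module.Dual A P)) :
    Submodule q.asIdeal.ResidueField (P → q.asIdeal.ResidueField) :=
  Submodule.span _ (Set.image (evAt q) S)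

/-- fibre rank -/
noncomputable def frk {A : Type*} [CommRing A] {P : Type*} [AddCommGroup P] [Module A P]
    (q : PrimeSpectrum A) (S : Set (Module.Dual A P)) : ℕ :=
  Module.finrank q.asIdeal.ResidueField (fsp q S)

theorem fsp_finite {A : Type*} [CommRing A] {P : Type*} [AddCommGroup P] [Module A P]
    (q : PrimeSpectrum A) {S : Set (Module.Dual A P)} (hS : S.Finite) :
    Module.Finite q.asIdeal.ResidueField (fsp q S) :=
  FiniteDimensional.span_of_finite _ (hS.image _)

theorem exists_cols {k : Type*} [Field k] {P : Type*} {d : ℕ} (v : Fin d → P → k)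
    (hv : LinearIndependent k v) : ∃ y : Fin d → P, (Matrix.of fun i j => v i (y j)).det ≠ 0 := by
  classical
  let c : P → Fin d → k := fun y i => v i y
  have hspan : Submodule.span k (Set.range c) = ⊤ := by
    by_contra hne
    obtain ⟨g, hg0, hg⟩ := Submodule.exists_le_ker_of_lt_top _ (lt_top_iff_ne_top.mpr hne)
    apply hg0
    have h1 : ∑ i, g (Pi.single i 1) • v i = 0 := by
      ext y
      have h2 : g (c y) = 0 := hg (Submodule.subset_span ⟨y, rfl⟩)
      rw [pi_eq_sum_univ' (c y)] at h2
      simp only [map_sum, map_smul] at h2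
      simp only [Finset.sum_apply, Pi.smul_apply, smul_eq_mul, Pi.zero_apply]
      rw [← h2]
      refine Finset.sum_congr rfl fun i _ => ?_
      simp [c, mul_comm]
    have h3 := Fintype.linearIndependent_iff.mp hv _ h1
    apply LinearMap.pi_ext'
    intro i
    ext
    simpa using h3 i
  have hd : Module.finrank k (Submodule.span k (Set.range c)) = d := by
    rw [hspan]; simp
  have hex := Submodule.exists_fun_fin_finrank_span_eq k (Set.range c)
  rw [hd] at hex
  obtain ⟨f, hf1, -, hf3⟩ := hex
  choose y hy using hf1
  refine ⟨y, ?_⟩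
  have h4 : (Matrix.of fun i j => v i (y j)).col = f := by
    ext j i
    rw [← hy j]; rfl
  rw [← h4, Matrix.linearIndependent_cols_iff_isUnit, Matrix.isUnit_iff_isUnit_det] at hf3
  exact hf3.ne_zero

theorem minor_of_le_frk {A : Type*} [CommRing A] {P : Type*} [AddCommGroup P] [Module A P]
    (q : PrimeSpectrum A) {S : Set (Module.Dual A P)} (hS : S.Finite) {d : ℕ}
    (hd : d ≤ frk q S) :
    ∃ (φ : Fin d → Module.Dual A P) (y : Fin d → P), (∀ i, φ i ∈ S) ∧
      (Matrix.of fun i j => φ i (y j)).det ∉ q.asIdeal := by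
  have := fsp_finite q hS
  unfold fsp at this
  obtain ⟨f, hf1, -, hf3⟩ :=
    Submodule.exists_fun_fin_finrank_span_eq q.asIdeal.ResidueField (Set.image (evAt q) S)
  choose φ hφ hφf using hf1
  have hli : LinearIndependent q.asIdeal.ResidueField (fun i => f (Fin.castLE hd i)) :=
    hf3.comp _ (Fin.castLE_injective hd)
  obtain ⟨y, hy⟩ := exists_cols _ hli
  refine ⟨fun i => φ (Fin.castLE hd i), y, fun i => hφ _, fun hmem => hy ?_⟩
  rw [← Ideal.algebraMap_residueField_eq_zero, RingHom.map_det] at hmem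
  rw [← hmem]
  congr 1
  ext i j
  simp [← hφf, evAt_apply]

theorem le_frk_of_minor {A : Type*} [CommRing A] {P : Type*} [AddCommGroup P] [Module A P]
    (q : PrimeSpectrum A) {S : Set (Module.Dual A P)} (hS : S.Finite) {d : ℕ}
    (φ : Fin d → Module.Dual A P) (y : Fin d → P) (hφ : ∀ i, φ i ∈ S)
    (hdet : (Matrix.of fun i j => φ i (y j)).det ∉ q.asIdeal) : d ≤ frk q S := by
  have := fsp_finite q hS
  have hli : LinearIndependent q.asIdeal.ResidueField (fun i => evAt q (φ i)) := by
    let L : (P → q.asIdeal.ResidueField) →ₗ[q.asIdeal.ResidueField]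
      (Fin d → q.asIdeal.ResidueField) := LinearMap.funLeft _ _ y
    apply LinearIndependent.of_comp L
    have h1 : ((algebraMap A q.asIdeal.ResidueField).mapMatrix
        (Matrix.of fun i j => φ i (y j))).row = L ∘ fun i => evAt q (φ i) := by
      ext i j
      simp [L, LinearMap.funLeft, evAt_apply, Matrix.row]
    rw [← h1, Matrix.linearIndependent_rows_iff_isUnit, Matrix.isUnit_iff_isUnit_det,
      ← RingHom.map_det, isUnit_iff_ne_zero]
    rwa [Ne, Ideal.algebraMap_residueField_eq_zero]
  have h2 := finrank_span_eq_card hli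
  rw [Fintype.card_fin] at h2
  rw [← h2]
  apply Submodule.finrank_mono
  apply Submodule.span_mono
  rintro _ ⟨i, rfl⟩
  exact ⟨φ i, hφ i, rfl⟩

/-- The ideal of minors. -/
noncomputable def minorIdeal {A : Type*} [CommRing A] {P : Type*} [AddCommGroup P] [Module A P]
    (S : Set (Module.Dual A P)) (d : ℕ) : Ideal A :=
  Ideal.span {a | ∃ (φ : Fin d → Module.Dual A P) (y : Fin d → P), (∀ i, φ i ∈ S) ∧
      (Matrix.of fun i j => φ i (y j)).det = a}

theorem minorIdeal_le_iff {A : Type*} [CommRing A] {P : Type*} [AddCommGroup P] [Module A P]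
    (q : PrimeSpectrum A) {S : Set (Module.Dual A P)} (hS : S.Finite) {d : ℕ} :
    minorIdeal S d ≤ q.asIdeal ↔ frk q S < d := by
  constructor
  · intro h
    by_contra! hd
    obtain ⟨φ, y, hφ, hdet⟩ := minor_of_le_frk q hS hd
    exact hdet (h (Ideal.subset_span ⟨φ, y, hφ, rfl⟩))
  · intro h
    rw [minorIdeal, Ideal.span_le]
    rintro _ ⟨φ, y, hφ, rfl⟩
    by_contra hdet
    exact absurd (le_frk_of_minor q hS φ y hφ hdet) (by omega)

theorem frk_anti {A : Type*} [CommRing A] {P : Type*} [AddCommGroup P] [Module A P]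
    {q' q : PrimeSpectrum A} (h : q' ≤ q) {S : Set (Module.Dual A P)} (hS : S.Finite) :
    frk q S ≤ frk q' S := by
  by_contra! hlt
  rw [← minorIdeal_le_iff q' hS] at hlt
  have := (minorIdeal_le_iff q hS).mp (hlt.trans h)
  omega

theorem frk_mono {A : Type*} [CommRing A] {P : Type*} [AddCommGroup P] [Module A P]
    (q : PrimeSpectrum A) {S T : Set (Module.Dual A P)} (hT : T.Finite) (h : S ⊆ T) :
    frk q S ≤ frk q T := by
  have := fsp_finite q hT
  exact Submodule.finrank_mono (Submodule.span_mono (Set.image_mono h))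

theorem fsp_insert_of_mem {A : Type*} [CommRing A] {P : Type*} [AddCommGroup P] [Module A P]
    (q : PrimeSpectrum A) {S : Set (Module.Dual A P)} {φ : Module.Dual A P}
    (h : evAt q φ ∈ fsp q S) : fsp q (insert φ S) = fsp q S := by
  unfold fsp at *
  rw [Set.image_insert_eq, Submodule.span_insert_eq_span h]

theorem mem_fsp_of_frk_le {A : Type*} [CommRing A] {P : Type*} [AddCommGroup P] [Module A P]
    (q : PrimeSpectrum A) {S : Set (Module.Dual A P)} (hS : S.Finite) {φ : Module.Dual A P}
    (h : frk q (insert φ S) ≤ frk q S) : evAt q φ ∈ fsp q S := by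
  have := fsp_finite q (hS.insert φ)
  have hle : fsp q S ≤ fsp q (insert φ S) :=
    Submodule.span_mono (Set.image_mono (Set.subset_insert _ _))
  rw [Submodule.eq_of_le_of_finrank_le hle h]
  exact Submodule.subset_span ⟨φ, Set.mem_insert _ _, rfl⟩

theorem frk_insert_le {A : Type*} [CommRing A] {P : Type*} [AddCommGroup P] [Module A P]
    (q : PrimeSpectrum A) {S : Set (Module.Dual A P)} (hS : S.Finite) {φ : Module.Dual A P} :
    frk q (insert φ S) ≤ frk q S + 1 := by
  have := fsp_finite q hS
  have h1 : fsp q (insert φ S) = Submodule.span _ {evAt q φ} ⊔ fsp q S := by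
    unfold fsp
    rw [Set.image_insert_eq, Submodule.span_insert]
  unfold frk
  rw [h1, add_comm]
  refine (Submodule.finrank_add_le_finrank_add_finrank _ _).trans ?_
  have h2 := finrank_span_le_card (R := q.asIdeal.ResidueField) ({evAt q φ} : Set _)
  simp only [Set.toFinset_singleton, Finset.card_singleton] at h2
  omega

/-- Avoiding one coset for each of finitely many primes. -/
theorem avoid {A : Type*} [CommRing A] (I : Ideal A) (F : PrimeSpectrum A → Set A)
    (hF : ∀ q, ∀ b ∈ F q, ∀ b' ∈ F q, b - b' ∈ q.asIdeal)
    (hF' : ∀ q, ∀ b ∈ F q, ∀ c ∈ q.asIdeal, b - c ∈ F q) (B : Finset (PrimeSpectrum A)) :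
    (∀ q ∈ B, ¬ I ≤ q.asIdeal) → ∃ b ∈ I, ∀ q ∈ B, b ∉ F q := by
  classical
  induction B using Finset.strongInduction with
  | H B ih =>
    intro hB
    rcases B.eq_empty_or_nonempty with rfl | hne
    · exact ⟨0, I.zero_mem, by simp⟩
    obtain ⟨q, hq⟩ := B.exists_minimal hne
    obtain ⟨b, hbI, hb⟩ := ih (B.erase q) (Finset.erase_ssubset hq.1)
      (fun p hp => hB p (Finset.mem_of_mem_erase hp))
    by_cases hbq : b ∈ F q
    · have h1 : ¬ I * ∏ p ∈ B.erase q, p.asIdeal ≤ q.asIdeal := by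
        rw [q.isPrime.mul_le, q.isPrime.prod_le]
        rintro (h | ⟨p, hp, hpq⟩)
        · exact hB q hq.1 h
        · have hle : p ≤ q := hpq
          have hge : q ≤ p := hq.2 (Finset.mem_of_mem_erase hp) hle
          exact (Finset.ne_of_mem_erase hp) (le_antisymm hle hge)
      obtain ⟨c, hc, hcq⟩ := SetLike.not_le_iff_exists.mp h1
      have hcI : c ∈ I := (Ideal.mul_le_left : I * ∏ p ∈ B.erase q, p.asIdeal ≤ I) hc
      have hcp : ∀ p ∈ B.erase q, c ∈ p.asIdeal := by
        intro p hp
        have h2 : c ∈ ∏ p ∈ B.erase q, p.asIdeal :=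
          (Ideal.mul_le_right : I * ∏ p ∈ B.erase q, p.asIdeal ≤ _) hc
        have h3 : ∏ p ∈ B.erase q, p.asIdeal ≤ p.asIdeal :=
          (Ideal.prod_le_inf (s := B.erase q) (f := PrimeSpectrum.asIdeal)).trans
            (Finset.inf_le hp)
        exact h3 h2
      refine ⟨b + c, I.add_mem hbI hcI, fun p hp hmem => ?_⟩
      by_cases hpq : p = q
      · subst hpq
        have := hF p _ hmem _ hbq
        rw [add_sub_cancel_left] at this
        exact hcq this
      · have hp' : p ∈ B.erase q := Finset.mem_erase.mpr ⟨hpq, hp⟩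
        apply hb p hp'
        simpa using hF' p _ hmem c (hcp p hp')
    · refine ⟨b, hbI, fun p hp => ?_⟩
      by_cases hpq : p = q
      · rwa [hpq]
      · exact hb p (Finset.mem_erase.mpr ⟨hpq, hp⟩)
open scoped TensorProduct in
theorem le_frk_gens {A : Type*} [CommRing A] {P : Type*} [AddCommGroup P] [Module A P]
    [Module.Finite A P] [Module.Projective A P] :
    ∃ S : Set (Module.Dual A P), S.Finite ∧ ∀ q : PrimeSpectrum A,
      Module.rankAtStalk P q ≤ frk q S := by
  obtain ⟨m, g, h, -, -, hgh⟩ := Module.Finite.exists_comp_eq_id_of_projective A P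
  let φ : Fin m → Module.Dual A P := fun i => LinearMap.proj i ∘ₗ h
  refine ⟨Set.range φ, Set.finite_range φ, fun q => ?_⟩
  have := fsp_finite q (Set.finite_range φ)
  let k := q.asIdeal.ResidueField
  have hdecomp : ∀ y : P, y = ∑ i, φ i y • g (Pi.single i 1) := by
    intro y
    conv_lhs => rw [← LinearMap.id_apply (R := A) y, ← hgh, LinearMap.comp_apply,
      pi_eq_sum_univ' (h y), map_sum]
    simp [φ]
  have hrk : Module.rankAtStalk P q = Module.finrank k (TensorProduct A k P) :=
    Module.rankAtStalk_eq q
  let T : Module.Dual k (TensorProduct A k P) →ₗ[k] (P → k) :=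
    { toFun := fun l y => l (1 ⊗ₜ[A] y)
      map_add' := fun l l' => by ext; simp
      map_smul' := fun a l => by ext; simp }
  have hT : Function.Injective T := by
    intro l l' hll
    apply TensorProduct.AlgebraTensorModule.curry_injective
    ext y
    exact congrFun hll y
  have hTr : ∀ l, T l ∈ fsp q (Set.range φ) := by
    intro l
    have : T l = ∑ i, l (1 ⊗ₜ[A] g (Pi.single i 1)) • evAt q (φ i) := by
      ext y
      change l (1 ⊗ₜ[A] y) = _
      conv_lhs => rw [hdecomp y, TensorProduct.tmul_sum, map_sum]
      rw [Finset.sum_apply]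
      refine Finset.sum_congr rfl fun i _ => ?_
      rw [← TensorProduct.smul_tmul, Algebra.smul_def, mul_one, ← mul_one (algebraMap A _ _),
        ← smul_eq_mul, ← TensorProduct.smul_tmul', map_smul, Pi.smul_apply, evAt_apply,
        smul_eq_mul, smul_eq_mul, mul_comm]
    rw [this]
    exact Submodule.sum_mem _ fun i _ => Submodule.smul_mem _ _
      (Submodule.subset_span ⟨φ i, ⟨i, rfl⟩, rfl⟩)
  rw [hrk, ← Subspace.dual_finrank_eq]
  exact LinearMap.finrank_le_finrank_of_injective (f := T.codRestrict (fsp q (Set.range φ)) hTr)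
    ((LinearMap.injective_codRestrict_iff _).mpr hT)

/-- The height of a prime containing `K` inside `V(K)`. -/
noncomputable def relHt {A : Type*} [CommRing A] (K : Ideal A) (q : PrimeSpectrum A)
    (h : K ≤ q.asIdeal) : ℕ∞ :=
  Order.height (⟨q, h⟩ : PrimeSpectrum.zeroLocus (K : Set A))

theorem relHt_lt {A : Type*} [CommRing A] (K : Ideal A) {q' q : PrimeSpectrum A}
    (h' : K ≤ q'.asIdeal) (h : K ≤ q.asIdeal) (hlt : q' < q) (hfin : relHt K q h < ⊤) :
    relHt K q' h' < relHt K q h := by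
  have h1 : (⟨q', h'⟩ : PrimeSpectrum.zeroLocus (K : Set A)) < ⟨q, h⟩ := hlt
  exact Order.height_strictMono h1 (lt_of_le_of_lt (Order.height_mono h1.le) hfin)

theorem relHt_le_height {A : Type*} [CommRing A] (K : Ideal A) {q : PrimeSpectrum A}
    (h : K ≤ q.asIdeal) : relHt K q h ≤ Order.height q :=
  Order.height_le_height_apply_of_strictMono (fun x : PrimeSpectrum.zeroLocus (K : Set A) => x.1)
    (fun _ _ h => h) _

theorem relHt_le_dim {A : Type*} [CommRing A] (K : Ideal A) {q : PrimeSpectrum A}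
    (h : K ≤ q.asIdeal) : (relHt K q h : WithBot ℕ∞) ≤ ringKrullDim (A ⧸ K) := by
  rw [ringKrullDim_quotient]
  exact Order.height_le_krullDim _

theorem bad_finite {A : Type*} [CommRing A] [IsNoetherianRing A]
    {P : Type*} [AddCommGroup P] [Module A P] (n : ℕ) (I K : Ideal A)
    {T : Set (Module.Dual A P)} (hT : T.Finite) (Δ : Module.Dual A P)
    (hyp : ∀ q : PrimeSpectrum A, ¬ I ≤ q.asIdeal → ∀ h : K ≤ q.asIdeal,
      evAt q Δ ∈ fsp q T → (n : ℕ∞) ≤ relHt K q h + frk q T) :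
    {q : PrimeSpectrum A | ¬ I ≤ q.asIdeal ∧ ∃ h : K ≤ q.asIdeal,
      evAt q Δ ∈ fsp q T ∧ relHt K q h + frk q T = n}.Finite := by
  have hfin : (⋃ d ∈ Finset.range (n + 1), Set.preimage PrimeSpectrum.asIdeal
      (K ⊔ minorIdeal (insert Δ T) (d + 1)).minimalPrimes).Finite := by
    refine Set.Finite.biUnion (Finset.finite_toSet _) fun d _ => ?_
    refine Set.Finite.preimage ?_ (Ideal.finite_minimalPrimes_of_isNoetherianRing A _)
    intro p _ q _ h
    exact PrimeSpectrum.ext h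
  refine hfin.subset ?_
  rintro q ⟨hqI, hqK, hmem, heq⟩
  have hTi := hT.insert Δ
  have hd : frk q T < n + 1 := by
    have h1 : (frk q T : ℕ∞) ≤ n := by rw [← heq]; exact le_add_self
    have := Nat.cast_le.mp h1
    omega
  have hht : relHt K q hqK < ⊤ := by
    refine lt_of_le_of_lt (le_self_add.trans heq.le) (ENat.natCast_lt_top n)
  simp only [Set.mem_iUnion, Set.mem_preimage]
  refine ⟨frk q T, Finset.mem_range.mpr hd, ?_⟩
  refine ⟨⟨q.isPrime, sup_le hqK ?_⟩, ?_⟩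
  · rw [minorIdeal_le_iff q hTi, frk, fsp_insert_of_mem q hmem]
    exact Nat.lt_succ_self _
  · rintro p ⟨hp, hple⟩ hpq
    by_contra hnot
    let q' : PrimeSpectrum A := ⟨p, hp⟩
    have hle : q' ≤ q := hpq
    have hlt : q' < q := lt_of_le_not_ge hle hnot
    have hK' : K ≤ q'.asIdeal := le_sup_left.trans hple
    have h1 : frk q' (insert Δ T) < frk q T + 1 :=
      (minorIdeal_le_iff q' hTi).mp (le_sup_right.trans hple)
    have h2 : frk q T ≤ frk q' T := frk_anti hle hT
    have h3 : frk q' T ≤ frk q' (insert Δ T) := frk_mono q' hTi (Set.subset_insert _ _)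
    have hmem' : evAt q' Δ ∈ fsp q' T := mem_fsp_of_frk_le q' hT (by omega)
    have h4 := hyp q' (fun h => hqI (h.trans hpq)) hK' hmem'
    have h5 := relHt_lt K hK' hqK hlt hht
    have h6 : frk q' T = frk q T := by omega
    rw [h6, ← heq] at h4
    exact absurd ((ENat.add_lt_add_iff_right (ENat.natCast_ne_top _)).mpr h5) (not_lt.mpr h4)

theorem step_lemma {A : Type*} [CommRing A] [IsNoetherianRing A]
    {P : Type*} [AddCommGroup P] [Module A P] (n : ℕ) (I : Ideal A) {ι : Type*} [Finite ι]
    (K : ι → Ideal A)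
    {S : Set (Module.Dual A P)} (hS : S.Finite) : ∀ (Δ : Module.Dual A P),
    (∀ i, ∀ q : PrimeSpectrum A, ¬ I ≤ q.asIdeal → ∀ h : K i ≤ q.asIdeal,
      evAt q Δ ∈ fsp q S → (n : ℕ∞) ≤ relHt (K i) q h + frk q S) →
    ∃ Θ : Module.Dual A P, (∀ p, Θ p - Δ p ∈ I) ∧
    (∀ i, ∀ q : PrimeSpectrum A, ¬ I ≤ q.asIdeal → ∀ h : K i ≤ q.asIdeal,
      LinearMap.range Θ ≤ q.asIdeal → (n : ℕ∞) ≤ relHt (K i) q h) := by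
  classical
  induction S, hS using Set.Finite.induction_on with
  | empty =>
    intro Δ hyp
    refine ⟨Δ, fun p => by simp, fun i q hq h hr => ?_⟩
    have h0 : evAt q Δ = 0 := by
      ext y
      rw [evAt_apply, Pi.zero_apply, Ideal.algebraMap_residueField_eq_zero]
      exact hr ⟨y, rfl⟩
    have := hyp i q hq h (by rw [h0]; exact Submodule.zero_mem _)
    have hz : frk q (∅ : Set (Module.Dual A P)) = 0 := by
      rw [frk, fsp, Set.image_empty, Submodule.span_empty, finrank_bot]
    rwa [hz, Nat.cast_zero, add_zero] at this
  | @insert ψ S _ hS ih =>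
    intro Δ hyp
    have hT := hS.insert ψ
    have hB := Set.finite_iUnion fun i => bad_finite n I (K i) hT Δ (hyp i)
    let F : PrimeSpectrum A → Set A := fun q =>
      {b | evAt q ψ ∉ fsp q S ∧ evAt q (Δ + b • ψ) ∈ fsp q S}
    have hsm : ∀ (q : PrimeSpectrum A) (c : A),
        evAt q (c • ψ) = algebraMap A q.asIdeal.ResidueField c • evAt q ψ := by
      intro q c
      ext y
      simp [evAt_apply]
    obtain ⟨b, hbI, hb⟩ := avoid I F (by
        rintro q b ⟨hψ, h1⟩ b' ⟨-, h2⟩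
        by_contra hne
        have h3 := Submodule.sub_mem _ h1 h2
        rw [map_add, map_add, add_sub_add_left_eq_sub, hsm, hsm, ← sub_smul, ← map_sub] at h3
        rw [← Ideal.algebraMap_residueField_eq_zero] at hne
        exact hψ ((Submodule.smul_mem_iff _ hne).mp h3)) (by
        rintro q b ⟨hψ, h1⟩ c hc
        refine ⟨hψ, ?_⟩
        rw [map_add, hsm, map_sub, Ideal.algebraMap_residueField_eq_zero.mpr hc, sub_zero,
          ← hsm, ← map_add]
        exact h1) hB.toFinset (by
        intro q hq
        rw [Set.Finite.mem_toFinset, Set.mem_iUnion] at hq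
        obtain ⟨i, hi, -⟩ := hq
        exact hi)
    have hsub : ∀ q : PrimeSpectrum A, fsp q S ≤ fsp q (insert ψ S) := fun q =>
      Submodule.span_mono (Set.image_mono (Set.subset_insert _ _))
    obtain ⟨Θ, hΘ1, hΘ2⟩ := ih (Δ + b • ψ) (by
      intro i q hq hK hmem
      have hmemT : evAt q Δ ∈ fsp q (insert ψ S) := by
        have h1 : evAt q Δ = evAt q (Δ + b • ψ) - evAt q (b • ψ) := by
          rw [← map_sub, add_sub_cancel_right]
        rw [h1, hsm]
        exact Submodule.sub_mem _ (hsub q hmem) (Submodule.smul_mem _ _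
          (Submodule.subset_span ⟨ψ, Set.mem_insert _ _, rfl⟩))
      have h2 := hyp i q hq hK hmemT
      by_cases hψ : evAt q ψ ∈ fsp q S
      · rwa [frk, fsp_insert_of_mem q hψ] at h2
      · have hne : relHt (K i) q hK + frk q (insert ψ S) ≠ n := by
          intro heq
          refine hb q ?_ ⟨hψ, hmem⟩
          rw [Set.Finite.mem_toFinset, Set.mem_iUnion]
          exact ⟨i, hq, hK, hmemT, heq⟩
        have h3 : (n : ℕ∞) < relHt (K i) q hK + frk q (insert ψ S) := lt_of_le_of_ne h2 hne.symm
        have h4 : (n : ℕ∞) < relHt (K i) q hK + frk q S + 1 := by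
          refine lt_of_lt_of_le h3 ?_
          rw [add_assoc]
          gcongr
          exact_mod_cast frk_insert_le q hS
        exact Order.le_of_lt_add_one h4)
    refine ⟨Θ, fun p => ?_, hΘ2⟩
    have h1 := hΘ1 p
    have h2 : Θ p - Δ p = (Θ p - (Δ + b • ψ) p) + b * ψ p := by
      simp only [LinearMap.add_apply, LinearMap.smul_apply, smul_eq_mul]
      ring
    rw [h2]
    exact I.add_mem h1 (I.mul_mem_right _ hbI)

/-- **Moving Lemma.**  Let `A` be a commutative Noetherian ring, `J` an ideal, `f ∈ A`, and
`P` a finitely generated projective `A`-module of constant rank `n ≥ dim (A/J) + 1`.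
Any `Δ : P → A` with `Δ(P) ⊆ J` and `Δ(P) + J²f = J` can be modified by an element of
`J²f` (i.e. lifted from the induced surjection `P ↠ J/(J²f)`) to a map `Θ` such that,
writing `J'' = Θ(P)`:  (i) `J'' + (J² ∩ K)f = J`; (ii) `J'' = J ∩ J'` with `ht J' ≥ n`;
(iii) `J' + (J² ∩ K)f = A`, for any given ideal `K` with `dim (A/K) ≤ n - 1`. -/
theorem moving_lemma {A : Type*} [CommRing A] [IsNoetherianRing A]
    {P : Type*} [AddCommGroup P] [Module A P] [Module.Finite A P] [Module.Projective A P]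
    (n : ℕ) (hrank : ∀ p : PrimeSpectrum A, Module.rankAtStalk P p = n)
    (J : Ideal A) (f : A)
    (hdim : ringKrullDim (A ⧸ J) + 1 ≤ (n : WithBot ℕ∞))
    (Δ : P →ₗ[A] A) (hΔ : LinearMap.range Δ ≤ J)
    (hsurj : LinearMap.range Δ ⊔ J ^ 2 * Ideal.span {f} = J)
    (K : Ideal A) (hK : ringKrullDim (A ⧸ K) + 1 ≤ (n : WithBot ℕ∞)) :
    ∃ Θ : P →ₗ[A] A,
      (∀ p : P, Θ p - Δ p ∈ J ^ 2 * Ideal.span {f}) ∧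
      LinearMap.range Θ ⊔ (J ^ 2 ⊓ K) * Ideal.span {f} = J ∧
      ∃ J' : Ideal A,
        LinearMap.range Θ = J ⊓ J' ∧
        (n : ℕ∞) ≤ idealHeight J' ∧
        J' ⊔ (J ^ 2 ⊓ K) * Ideal.span {f} = ⊤ := by
  obtain ⟨S, hS, hSn⟩ := le_frk_gens (A := A) (P := P)
  have hIJ2 : J ^ 2 * Ideal.span {f} ≤ J ^ 2 := Ideal.mul_le_left
  have hJ2J : J ^ 2 ≤ J := Ideal.pow_le_self two_ne_zero
  have hLI : (J ^ 2 ⊓ K) * Ideal.span {f} ≤ J ^ 2 * Ideal.span {f} :=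
    Ideal.mul_mono_left inf_le_left
  obtain ⟨Θ, hΘ1, hΘ2⟩ := step_lemma n (J ^ 2 * Ideal.span {f})
    (fun b : Bool => if b then K else ⊥) hS Δ (by
      intro i q _ h _
      have h1 := hSn q
      rw [hrank q] at h1
      exact (Nat.cast_le.mpr h1).trans le_add_self)
  have hht : ∀ q : PrimeSpectrum A, ¬ J ^ 2 * Ideal.span {f} ≤ q.asIdeal →
      LinearMap.range Θ ≤ q.asIdeal → (n : ℕ∞) ≤ Order.height q := fun q hq hr =>
    (hΘ2 false q hq (by simp) hr).trans (relHt_le_height _ _)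
  have hnoK : ∀ q : PrimeSpectrum A, ¬ J ^ 2 * Ideal.span {f} ≤ q.asIdeal →
      LinearMap.range Θ ≤ q.asIdeal → ¬ K ≤ q.asIdeal := by
    intro q hq hr hKq
    have h1 : (n : ℕ∞) ≤ relHt K q hKq := hΘ2 true q hq hKq hr
    have h2 := relHt_le_dim K hKq
    have h3 : ((n : ℕ∞) : WithBot ℕ∞) ≤ (relHt K q hKq : WithBot ℕ∞) := by exact_mod_cast h1
    have h4 : ((n : ℕ∞) : WithBot ℕ∞) + 1 ≤ n := by
      refine le_trans ?_ hK
      gcongr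
      exact h3.trans h2
    have h5 : n + 1 ≤ n := by exact_mod_cast h4
    omega
  have hΘJ : LinearMap.range Θ ⊔ J ^ 2 * Ideal.span {f} = J := by
    rw [← hsurj]
    conv_lhs => rw [hsurj]
    apply le_antisymm
    · refine sup_le ?_ le_sup_right
      rintro _ ⟨p, rfl⟩
      rw [← add_sub_cancel (Δ p) (Θ p)]
      exact Submodule.add_mem_sup ⟨p, rfl⟩ (hΘ1 p)
    · refine sup_le ?_ le_sup_right
      rintro _ ⟨p, rfl⟩
      rw [← sub_sub_cancel (Θ p) (Δ p)]
      exact Submodule.sub_mem _ (Submodule.mem_sup_left ⟨p, rfl⟩)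
        (Submodule.mem_sup_right (hΘ1 p))
  have hrJ : LinearMap.range Θ ≤ J := by rw [← hΘJ]; exact le_sup_left
  obtain ⟨r, hr1, hr2⟩ := Submodule.exists_sub_one_mem_and_smul_le_of_fg_of_le_sup
    (I := J) (N := LinearMap.range Θ) (N' := J) (P := J) (IsNoetherian.noetherian J) le_rfl (by
      conv_lhs => rw [← hΘJ]
      refine sup_le_sup_left (hIJ2.trans ?_) _
      rw [pow_two]; exact le_rfl)
  have hrmul : ∀ x ∈ J, r * x ∈ LinearMap.range Θ := fun x hx =>
    hr2 (Submodule.smul_mem_pointwise_smul x r J hx)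
  let J' : Ideal A := LinearMap.range Θ ⊔ Ideal.span {r}
  have hU : ∀ q : PrimeSpectrum A, J' ≤ q.asIdeal → ¬ J ^ 2 * Ideal.span {f} ≤ q.asIdeal := by
    intro q hq hI
    have h1 : J ≤ q.asIdeal := by
      rw [← hΘJ]; exact sup_le (le_sup_left.trans hq) hI
    have h2 : r ∈ q.asIdeal := hq (Submodule.mem_sup_right (Ideal.mem_span_singleton_self r))
    have h3 := q.asIdeal.sub_mem h2 (h1 hr1)
    rw [sub_sub_cancel] at h3
    exact q.isPrime.ne_top ((Ideal.eq_top_iff_one _).mpr h3)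
  have hcap : LinearMap.range Θ = J ⊓ J' := by
    apply le_antisymm (le_inf hrJ le_sup_left)
    rintro x ⟨hxJ, hxJ'⟩
    obtain ⟨t, ht, s, hs, rfl⟩ := Submodule.mem_sup.mp hxJ'
    obtain ⟨c, rfl⟩ := Ideal.mem_span_singleton'.mp hs
    have h1 : c * r ∈ J := by simpa using J.sub_mem hxJ (hrJ ht)
    have h2 : c ∈ J := by
      have : c = c * r - c * (r - 1) := by ring
      rw [this]
      exact J.sub_mem h1 (J.mul_mem_left _ hr1)
    refine Submodule.add_mem _ ht ?_
    rw [mul_comm]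
    exact hrmul c h2
  have htop : J' ⊔ (J ^ 2 ⊓ K) * Ideal.span {f} = ⊤ := by
    by_contra hne
    obtain ⟨m, hm, hle⟩ := Ideal.exists_le_maximal _ hne
    let q : PrimeSpectrum A := ⟨m, hm.isPrime⟩
    have hJ'q : J' ≤ q.asIdeal := le_sup_left.trans hle
    have hIq := hU q hJ'q
    have hLq : (J ^ 2 ⊓ K) * Ideal.span {f} ≤ q.asIdeal := le_sup_right.trans hle
    rw [q.isPrime.mul_le] at hIq hLq
    push Not at hIq
    rcases hLq with h | h
    · rcases q.isPrime.inf_le.mp h with h | h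
      · exact hIq.1 h
      · exact hnoK q (hU q hJ'q) (le_sup_left.trans hJ'q) h
    · exact hIq.2 h
  refine ⟨Θ, hΘ1, ?_, J', hcap, ?_, htop⟩
  · apply le_antisymm (sup_le hrJ (hLI.trans (hIJ2.trans hJ2J)))
    intro j hj
    have h1 : (1 : A) ∈ J' ⊔ (J ^ 2 ⊓ K) * Ideal.span {f} := by rw [htop]; trivial
    obtain ⟨a, ha, l, hl, hal⟩ := Submodule.mem_sup.mp h1
    have h2 : j = j * a + j * l := by rw [← mul_add, hal, mul_one]
    rw [h2]
    refine Submodule.add_mem_sup ?_ (Ideal.mul_mem_left _ _ hl)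
    rw [hcap]
    exact ⟨Ideal.mul_mem_right _ _ hj, Ideal.mul_mem_left _ _ ha⟩
  · refine le_iInf₂ fun q hq => ?_
    exact hht q (hU q hq) (le_sup_left.trans hq)
end

section
/- Subtraction Principle: Let A be a commutative Noetherian ring and let I, J be comaximal ideals of A (I + J = A). Let P = Q ⊕ A be a finitely generated projective A-module of constant rank n (having a free direct summand) such that n ≥ dim(A/J) + 2 and n + ht I ≥ dim A + 3. Suppose Φ, Ψ : P → A are A-linear maps with Φ(P) = I, Ψ(P) = I ∩ J, and Φ(p) − Ψ(p) ∈ I² for all p ∈ P. Then there exists an A-linear map Δ : P → A with Δ(P) = J and Δ(p) − Ψ(p) ∈ J² for all p ∈ P. -/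
namespace SubtractionAux

variable {A : Type*} [CommRing A] {Q : Type*} [AddCommGroup Q] [Module A Q]

/-- The conclusion of the theorem, in terms of the two components `(ψ, b)` of `Ψ`. -/
def Good (J : Ideal A) (ψ : Q →ₗ[A] A) (b : A) : Prop :=
  ∃ (δ : Q →ₗ[A] A) (d : A), LinearMap.range δ ⊔ Ideal.span {d} = J ∧
    (∀ x, δ x - ψ x ∈ J ^ 2) ∧ d - b ∈ J ^ 2

lemma mem_rs {ψ : Q →ₗ[A] A} {b z : A} :
    z ∈ LinearMap.range ψ ⊔ Ideal.span {b} ↔ ∃ x y, z = ψ x + y * b := by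
  constructor
  · intro h
    obtain ⟨u, ⟨x, rfl⟩, v, hv, rfl⟩ := Submodule.mem_sup.mp h
    obtain ⟨y, rfl⟩ := Ideal.mem_span_singleton'.mp hv
    exact ⟨x, y, rfl⟩
  · rintro ⟨x, y, rfl⟩
    exact Submodule.add_mem_sup ⟨x, rfl⟩ (Ideal.mem_span_singleton'.mpr ⟨y, rfl⟩)

lemma rs_add (ψ : Q →ₗ[A] A) (b : A) (χ : Q →ₗ[A] A) :
    LinearMap.range (ψ + b • χ) ⊔ Ideal.span {b} = LinearMap.range ψ ⊔ Ideal.span {b} := by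
  ext z
  rw [mem_rs, mem_rs]
  constructor
  · rintro ⟨x, y, rfl⟩
    exact ⟨x, y + χ x, by simp; ring⟩
  · rintro ⟨x, y, rfl⟩
    exact ⟨x, y - χ x, by simp; ring⟩

lemma rs_add' (ψ : Q →ₗ[A] A) (b : A) (q : Q) :
    LinearMap.range ψ ⊔ Ideal.span {b + ψ q} = LinearMap.range ψ ⊔ Ideal.span {b} := by
  ext z
  rw [mem_rs, mem_rs]
  constructor
  · rintro ⟨x, y, rfl⟩
    exact ⟨x + y • q, y, by simp; ring⟩
  · rintro ⟨x, y, rfl⟩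
    exact ⟨x - y • q, y, by simp; ring⟩

lemma Good.of_add {J : Ideal A} {ψ : Q →ₗ[A] A} {b : A} (χ : Q →ₗ[A] A)
    (h : Good J (ψ + b • χ) b) : Good J ψ b := by
  obtain ⟨δ, d, h1, h2, h3⟩ := h
  refine ⟨δ + d • (-χ), d, ?_, ?_, h3⟩
  · rw [rs_add, h1]
  · intro x
    have := sub_mem (h2 x) (Ideal.mul_mem_right (χ x) _ h3)
    convert this using 1
    simp
    ring

lemma Good.of_add' {J : Ideal A} {ψ : Q →ₗ[A] A} {b : A} (q : Q)
    (h : Good J ψ (b + ψ q)) : Good J ψ b := by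
  obtain ⟨δ, d, h1, h2, h3⟩ := h
  refine ⟨δ, d + δ (-q), ?_, h2, ?_⟩
  · rw [rs_add', h1]
  · have := sub_mem h3 (h2 q)
    convert this using 1
    simp
    ring

/-- Last step: explicit formula. -/
lemma good_final [IsNoetherianRing A] {I J L : Ideal A} {φ ψ : Q →ₗ[A] A} {b : A}
    (hL : LinearMap.range φ = L) (hLI : L ≤ I) (hLJ : L ⊔ J = ⊤)
    (hψ : ∀ x, ψ x - φ x ∈ L ^ 2) (hI : LinearMap.range ψ ⊔ Ideal.span {b} = I ⊓ J) :
    Good J ψ b := by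
  set M : Ideal A := LinearMap.range ψ with hM
  have hφL : ∀ x, φ x ∈ L := fun x => hL.le ⟨x, rfl⟩
  have hML : M ≤ L := by
    rintro _ ⟨x, rfl⟩
    have := add_mem (Ideal.pow_le_self two_ne_zero (hψ x)) (hφL x)
    simpa using this
  -- Nakayama
  obtain ⟨s, hs1, hs2⟩ := Submodule.exists_sub_one_mem_and_smul_eq_zero_of_fg_of_le_smul L
    (Submodule.map M.mkQ L) ((IsNoetherian.noetherian L).map _) (by
      rw [← Submodule.map_smul'']
      rintro _ ⟨z, hz, rfl⟩
      have hz' : z ∈ LinearMap.range φ := by rw [hL]; exact hz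
      obtain ⟨x, rfl⟩ := hz'
      refine ⟨φ x - ψ x, ?_, ?_⟩
      · have := neg_mem (hψ x)
        rw [neg_sub, pow_two] at this
        simpa using this
      · rw [map_sub, sub_eq_self]
        exact (Submodule.Quotient.mk_eq_zero _).mpr ⟨x, rfl⟩)
  have hsL : ∀ z ∈ L, s * z ∈ M := by
    intro z hz
    have := hs2 _ (Submodule.mem_map_of_mem (f := M.mkQ) hz)
    rw [← map_smul] at this
    exact (Submodule.Quotient.mk_eq_zero _).mp this
  have hMb : ∀ z, z ∈ M → z ∈ I ⊓ J := fun z hz => hI ▸ Submodule.mem_sup_left hz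
  have hsJ : s ∈ J := by
    have h1 : (1 : A) ∈ L ⊔ J := hLJ ▸ Submodule.mem_top
    obtain ⟨l, hl, j, hj, e⟩ := Submodule.mem_sup.mp h1
    have : s = s * l + s * j := by rw [← mul_add, e, mul_one]
    rw [this]
    exact add_mem (hMb _ (hsL l hl)).2 (Ideal.mul_mem_left _ _ hj)
  set t := s ^ 2 with ht
  have htJ : t ∈ J ^ 2 := Ideal.pow_mem_pow hsJ 2
  have htJ1 : t ∈ J := Ideal.pow_le_self two_ne_zero htJ
  have ht1 : 1 - t ∈ L := by
    have := neg_mem (Ideal.mul_mem_left _ (s + 1) hs1)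
    convert this using 1
    rw [ht]; ring
  have htL : ∀ z ∈ L, t * z ∈ M := fun z hz => by
    have := Ideal.mul_mem_left _ s (hsL z hz)
    convert this using 1
    rw [ht]; ring
  refine ⟨ψ, b + t * (1 - b), ?_, fun x => by simp, ?_⟩
  · have hbJ : b ∈ I ⊓ J := hI ▸ Submodule.mem_sup_right (Ideal.mem_span_singleton_self b)
    set b' := b + t * (1 - b) with hb'
    apply le_antisymm
    · refine sup_le (fun z hz => (hMb z hz).2) ?_
      rw [Ideal.span_singleton_le_iff_mem]
      exact add_mem hbJ.2 (Ideal.mul_mem_right _ _ htJ1)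
    · set N : Ideal A := LinearMap.range ψ ⊔ Ideal.span {b'} with hN
      have hMN : ∀ z ∈ M, z ∈ N := fun z hz => Submodule.mem_sup_left hz
      have hbN : b' ∈ N := Submodule.mem_sup_right (Ideal.mem_span_singleton_self _)
      have h1 : t * (1 - t) ∈ N := hMN _ (htL _ ht1)
      have htN : t ∈ N := by
        have := add_mem (sub_mem (Ideal.mul_mem_left _ t hbN) (Ideal.mul_mem_right b _ h1)) h1
        convert this using 1
        rw [hb']; ring
      have hbN' : b ∈ N := by
        have := sub_mem hbN (Ideal.mul_mem_right (1 - b) _ htN)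
        convert this using 1
        rw [hb']; ring
      have hIJN : I ⊓ J ≤ N := by
        rw [← hI]
        exact sup_le (fun z hz => hMN z hz) ((Ideal.span_singleton_le_iff_mem _).mpr hbN')
      intro x hx
      have h2 : (1 - t) * x ∈ N := hIJN ⟨hLI (Ideal.mul_mem_right _ _ ht1), Ideal.mul_mem_left _ _ hx⟩
      have := add_mem h2 (Ideal.mul_mem_right x _ htN)
      convert this using 1
      ring
  · have := Ideal.mul_mem_right (1 - b) _ htJ
    convert this using 1
    ring

/-- Lifting: a functional with values in `N + a A` is `a η` modulo `N`. -/
lemma exists_lift_mod [Module.Projective A Q] (N K : Ideal A) (a : A) (θ : Q →ₗ[A] A)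
    (h : ∀ x, ∃ z ∈ K, θ x - a * z ∈ N) :
    ∃ η : Q →ₗ[A] A, (∀ x, η x ∈ K) ∧ ∀ x, θ x - a * η x ∈ N := by
  let g : K →ₗ[A] A ⧸ N := N.mkQ ∘ₗ (a • K.subtype)
  have hmem : ∀ x, (N.mkQ ∘ₗ θ) x ∈ LinearMap.range g := by
    intro x
    obtain ⟨z, hz, hzN⟩ := h x
    refine ⟨⟨z, hz⟩, ?_⟩
    have : N.mkQ (θ x - a * z) = 0 := (Submodule.Quotient.mk_eq_zero _).mpr hzN
    rw [map_sub, sub_eq_zero] at this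
    simpa [g] using this.symm
  obtain ⟨η, hη⟩ := Module.projective_lifting_property g.rangeRestrict
    ((N.mkQ ∘ₗ θ).codRestrict _ hmem) g.surjective_rangeRestrict
  refine ⟨K.subtype ∘ₗ η, fun x => (η x).2, fun x => ?_⟩
  have h1 := congrArg Subtype.val (LinearMap.congr_fun hη x)
  have h2 : N.mkQ (a * (η x : A)) = N.mkQ (θ x) := by simpa [g] using h1
  have h3 : N.mkQ (θ x - a * (η x : A)) = 0 := by rw [map_sub, h2, sub_self]
  exact (Submodule.Quotient.mk_eq_zero _).mp h3

lemma sq_le {L : Ideal A} {a : A} {z : A} (hz : z ∈ (L ⊔ Ideal.span {a}) ^ 2) :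
    ∃ y, z - a ^ 2 * y ∈ L * (L ⊔ Ideal.span {a}) := by
  have : (L ⊔ Ideal.span {a}) ^ 2 ≤ L * (L ⊔ Ideal.span {a}) ⊔ Ideal.span {a ^ 2} := by
    rw [pow_two, Ideal.sup_mul]
    refine sup_le le_sup_left ?_
    rw [Ideal.mul_sup, Ideal.span_singleton_mul_span_singleton, ← pow_two]
    refine sup_le (le_sup_of_le_left ?_) le_sup_right
    rw [mul_comm]
    exact Ideal.mul_mono_right le_sup_right
  obtain ⟨u, hu, v, hv, rfl⟩ := Submodule.mem_sup.mp (this hz)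
  obtain ⟨y, rfl⟩ := Ideal.mem_span_singleton'.mp hv
  exact ⟨y, by convert hu using 1; ring⟩

lemma LI_le {L : Ideal A} {a : A} {z : A} (hz : z ∈ L * (L ⊔ Ideal.span {a})) :
    ∃ y ∈ L, z - a * y ∈ L ^ 2 := by
  rw [Ideal.mul_sup, ← pow_two, mul_comm L (Ideal.span {a})] at hz
  obtain ⟨u, hu, v, hv, rfl⟩ := Submodule.mem_sup.mp hz
  obtain ⟨y, hy, rfl⟩ := Ideal.mem_span_singleton_mul.mp hv
  exact ⟨y, hy, by simpa using hu⟩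

/-- The case where `φ(Q)` is comaximal with `J` and unimodular elements mod `L` can be shortened. -/
lemma good_core [IsNoetherianRing A] [Module.Projective A Q] {I J L : Ideal A}
    {φ ψ : Q →ₗ[A] A} {a b : A}
    (hL : LinearMap.range φ = L) (hI : L ⊔ Ideal.span {a} = I) (hLJ : L ⊔ J = ⊤)
    (hψ : ∀ x, ψ x - φ x ∈ I ^ 2) (hb : b - a ∈ I ^ 2)
    (hr : LinearMap.range ψ ⊔ Ideal.span {b} = I ⊓ J)
    (hU : ∀ (η : Q →ₗ[A] A) (f : A),
      (∀ p : PrimeSpectrum A, L ≤ p.asIdeal → f ∈ p.asIdeal → ∃ x, η x ∉ p.asIdeal) →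
      ∃ χ : Q →ₗ[A] A, ∀ p : PrimeSpectrum A, L ≤ p.asIdeal → ∃ x, (η + f • χ) x ∉ p.asIdeal) :
    Good J ψ b := by
  have hφL : ∀ x, φ x ∈ L := fun x => hL.le ⟨x, rfl⟩
  have haI : a ∈ I := hI.le (Submodule.mem_sup_right (Ideal.mem_span_singleton_self a))
  have hLI : L ≤ I := le_sup_left.trans hI.le
  have hLIL : ∀ z, z ∈ L * I → z ∈ L := by
    intro z hz
    have h : L * I ≤ L := Ideal.mul_le_left
    exact h hz
  -- lifts
  obtain ⟨η, -, hη⟩ := exists_lift_mod (L * I) ⊤ (a ^ 2) (ψ - φ) (fun x => by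
    obtain ⟨y, hy⟩ := sq_le (L := L) (a := a) (by rw [hI]; exact hψ x)
    rw [hI] at hy
    exact ⟨y, trivial, hy⟩)
  obtain ⟨c, hc⟩ := sq_le (L := L) (a := a) (by rw [hI]; exact hb)
  rw [hI] at hc
  obtain ⟨χ, hχ⟩ := hU η (1 + a * c) (by
    intro p hp hf
    by_contra! hcon
    have ha : a ∉ p.asIdeal := by
      intro ha
      apply p.2.ne_top
      rw [Ideal.eq_top_iff_one]
      have := sub_mem hf (Ideal.mul_mem_right c _ ha)
      simpa using this
    have hIJ : I ⊓ J ≤ p.asIdeal := by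
      rw [← hr]
      refine sup_le ?_ ?_
      · rintro _ ⟨x, rfl⟩
        have h1 := hp (hLIL _ (hη x))
        have h2 := add_mem (add_mem h1 (hp (hφL x))) (Ideal.mul_mem_left _ (a ^ 2) (hcon x))
        convert h2 using 1
        rw [LinearMap.sub_apply]
        ring
      · rw [Ideal.span_singleton_le_iff_mem]
        have h2 := add_mem (hp (hLIL _ hc)) (Ideal.mul_mem_left _ a hf)
        convert h2 using 1
        ring
    rcases (p.2.inf_le).mp hIJ with h | h
    · exact ha (h haI)
    · apply p.2.ne_top
      rw [eq_top_iff, ← hLJ]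
      exact sup_le hp h)
  obtain ⟨f, hf⟩ : ∃ z, z = 1 + a * c := ⟨_, rfl⟩
  rw [← hf] at hχ
  obtain ⟨η', hη'⟩ : ∃ z, z = η + f • χ := ⟨_, rfl⟩
  rw [← hη'] at hχ
  have htop : LinearMap.range η' ⊔ L = ⊤ := by
    by_contra hne
    obtain ⟨m, hm, hle⟩ := Ideal.exists_le_maximal _ hne
    obtain ⟨x, hx⟩ := hχ ⟨m, hm.isPrime⟩ (le_sup_right.trans hle)
    exact hx (hle (Submodule.mem_sup_left ⟨x, rfl⟩))
  obtain ⟨q, hq⟩ : ∃ q, η' q - 1 ∈ L := by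
    have h1 : (1 : A) ∈ LinearMap.range η' ⊔ L := htop ▸ Submodule.mem_top
    obtain ⟨_, ⟨q, rfl⟩, l, hl, e⟩ := Submodule.mem_sup.mp h1
    refine ⟨q, ?_⟩
    rw [← e]
    simpa using neg_mem hl
  -- congruences mod `L * I`
  have hmulLI : ∀ {z}, z ∈ L → a * z ∈ L * I := fun {z} hz => by
    rw [mul_comm a]; exact Ideal.mul_mem_mul hz haI
  obtain ⟨ψ1, hψ1⟩ : ∃ z, z = ψ + b • (a • χ) := ⟨_, rfl⟩
  have e1 : ∀ x, ψ1 x - φ x - a ^ 2 * η' x ∈ L * I := by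
    intro x
    have h1 := add_mem (hη x) (Ideal.mul_mem_right (a * χ x) _ hc)
    convert h1 using 1
    simp [hψ1, hη', hf]
    ring
  obtain ⟨b2, hb2⟩ : ∃ z, z = b + ψ1 (-(c • q)) := ⟨_, rfl⟩
  have e2 : b2 - a + c * φ q ∈ L * I := by
    have h1 := sub_mem hc (Ideal.mul_mem_left _ c (e1 q))
    have h2 := Ideal.mul_mem_left _ (a * c) (hmulLI hq)
    have h3 := sub_mem h1 h2
    convert h3 using 1
    simp [hb2]
    ring
  have e2' : b2 - a ∈ L := by
    have := sub_mem (hLIL _ e2) (Ideal.mul_mem_left _ c (hφL q))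
    convert this using 1
    ring
  obtain ⟨ψ3, hψ3⟩ : ∃ z, z = ψ1 + b2 • (-(a • η')) := ⟨_, rfl⟩
  have e3 : ∀ x, ψ3 x - φ x ∈ L * I := by
    intro x
    have h1 := sub_mem (e1 x) (Ideal.mul_mem_right (η' x) _ (hmulLI e2'))
    convert h1 using 1
    simp [hψ3]
    ring
  obtain ⟨ξ, hξL, hξ⟩ := exists_lift_mod (L ^ 2) L a (ψ3 - φ) (fun x => by
    have := e3 x
    rw [← hI] at this
    exact LI_le this)
  obtain ⟨ψ5, hψ5⟩ : ∃ z, z = ψ3 + b2 • (-ξ) := ⟨_, rfl⟩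
  have e5 : ∀ x, ψ5 x - φ x ∈ L ^ 2 := by
    intro x
    have h0 : (b2 - a) * ξ x ∈ L ^ 2 := by rw [pow_two]; exact Ideal.mul_mem_mul e2' (hξL x)
    have h1 := sub_mem (hξ x) h0
    convert h1 using 1
    simp [hψ5]
    ring
  have r1 : LinearMap.range ψ5 ⊔ Ideal.span {b2} = I ⊓ J := by
    rw [hψ5, rs_add, hψ3, rs_add, hb2, rs_add', hψ1, rs_add, hr]
  have g5 : Good J ψ5 b2 := good_final hL hLI hLJ e5 r1
  rw [hψ5] at g5
  have g3 := g5.of_add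
  rw [hψ3] at g3
  have g2 := g3.of_add
  rw [hb2] at g2
  have g1 := g2.of_add'
  rw [hψ1] at g1
  exact g1.of_add

lemma avoid (F : Finset (PrimeSpectrum A)) (y b : A) (hb : ∀ p ∈ F, b ∉ p.asIdeal) :
    ∃ c, ∀ p ∈ F, y + b * c ∉ p.asIdeal := by
  classical
  induction hn : F.card generalizing F with
  | zero => exact ⟨0, by simp [Finset.card_eq_zero.mp hn]⟩
  | succ k ih =>
    have hne : F.Nonempty := by rw [← Finset.card_pos]; omega
    obtain ⟨m, hm, hmin⟩ := F.exists_minimal hne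
    obtain ⟨c, hc⟩ := ih (F.erase m) (fun p hp => hb p (Finset.mem_of_mem_erase hp))
      (by rw [Finset.card_erase_of_mem hm]; omega)
    by_cases h : y + b * c ∈ m.asIdeal
    · have hu : ¬ (F.erase m).inf (fun p => p.asIdeal) ≤ m.asIdeal := by
        intro hle
        obtain ⟨p, hp, hpm⟩ := (Ideal.IsPrime.inf_le' m.2).mp hle
        have hp' := Finset.mem_erase.mp hp
        exact hp'.1 (le_antisymm hpm (hmin hp'.2 hpm))
      obtain ⟨u, hu1, hu2⟩ := SetLike.not_le_iff_exists.mp hu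
      refine ⟨c + u, fun p hp hcon => ?_⟩
      have e : y + b * (c + u) = (y + b * c) + b * u := by ring
      rw [e] at hcon
      by_cases hpm : p = m
      · subst hpm
        have := (Ideal.add_mem_iff_right _ h).mp hcon
        rcases p.2.mem_or_mem this with h1 | h1
        · exact hb p hp h1
        · exact hu2 h1
      · have hp' := Finset.mem_erase.mpr ⟨hpm, hp⟩
        have hup : u ∈ p.asIdeal := (Finset.inf_le (f := fun p : PrimeSpectrum A => p.asIdeal) hp') hu1
        exact hc p hp' ((Ideal.add_mem_iff_left _ (Ideal.mul_mem_left _ b hup)).mp hcon)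
    · refine ⟨c, fun p hp => ?_⟩
      by_cases hpm : p = m
      · exact hpm ▸ h
      · exact hc p (Finset.mem_erase.mpr ⟨hpm, hp⟩)

/-- component-wise general position -/
lemma chain_avoid [IsNoetherianRing A] (K : Ideal A) (a : A) (r : ℕ) (w : PrimeSpectrum A → ℕ)
    (hw : ∀ p : PrimeSpectrum A, K ≤ p.asIdeal → a ∉ p.asIdeal → w p ≤ r)
    (hmono : ∀ q p : PrimeSpectrum A, K ≤ q.asIdeal → a ∉ p.asIdeal → q < p →
      w p = 0 ∨ w p < w q)
    (y : ℕ → A) (k : ℕ) :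
    ∃ c : ℕ → A, ∀ p : PrimeSpectrum A, K ≤ p.asIdeal → a ∉ p.asIdeal →
      (∀ i < k, y i + a * c i ∈ p.asIdeal) → w p ≤ r - k := by
  induction k with
  | zero => exact ⟨0, fun p h1 h2 _ => hw p h1 h2⟩
  | succ k ih =>
    obtain ⟨c, hc⟩ := ih
    let N : Ideal A := K ⊔ Ideal.span (Set.range fun i : Fin k => y i + a * c i)
    have hfin : {p : PrimeSpectrum A | p.asIdeal ∈ N.minimalPrimes ∧ a ∉ p.asIdeal}.Finite := by
      apply Set.Finite.subset ((N.finite_minimalPrimes_of_isNoetherianRing A).preimage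
        (f := PrimeSpectrum.asIdeal) (fun p _ q _ h => PrimeSpectrum.ext h))
      exact fun p hp => hp.1
    obtain ⟨d, hd⟩ := avoid hfin.toFinset (y k) a (fun p hp => by
      simpa using ((Set.Finite.mem_toFinset hfin).mp hp).2)
    refine ⟨Function.update c k d, fun p hK ha hp => ?_⟩
    have hp1 : ∀ i < k, y i + a * c i ∈ p.asIdeal := fun i hi => by
      have := hp i (by omega)
      rwa [Function.update_of_ne (by omega)] at this
    have hp2 : y k + a * d ∈ p.asIdeal := by simpa using hp k (by omega)
    have hN : N ≤ p.asIdeal := by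
      refine sup_le hK (Ideal.span_le.mpr ?_)
      rintro _ ⟨i, rfl⟩
      exact hp1 i i.2
    obtain ⟨q, hq, hqp⟩ := Ideal.exists_minimalPrimes_le hN
    let q' : PrimeSpectrum A := ⟨q, hq.1.1⟩
    have haq : a ∉ q := fun h => ha (hqp h)
    have hlt : q' < p := by
      refine lt_of_le_of_ne hqp ?_
      intro e
      exact hd q' (by simpa using ⟨hq, haq⟩) (e ▸ hp2)
    have hKq : K ≤ q := le_sup_left.trans hq.1.2
    have h1 := hc q' hKq haq (fun i hi => hq.1.2
      (Submodule.mem_sup_right (Ideal.subset_span ⟨⟨i, hi⟩, rfl⟩)))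
    rcases hmono q' p hKq ha hlt with h | h <;> omega

/-- local freeness of rank `r` -/
def LocFree (A Q : Type*) [CommRing A] [AddCommGroup Q] [Module A Q] (r : ℕ) : Prop :=
  ∀ p : PrimeSpectrum A, ∃ s ∉ p.asIdeal, ∃ (l : (Fin r → A) →ₗ[A] Q) (l' : Q →ₗ[A] (Fin r → A)),
    (∀ x, l (l' x) = s • x) ∧ ∀ x, l' (l x) = s • x

lemma gp [IsNoetherianRing A] {r : ℕ} (hQ : LocFree A Q r) (a : A)
    (w : PrimeSpectrum A → ℕ) (K : Ideal A)
    (hw : ∀ p : PrimeSpectrum A, K ≤ p.asIdeal → a ∉ p.asIdeal → w p ≤ r)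
    (hmono : ∀ q p : PrimeSpectrum A, K ≤ q.asIdeal → a ∉ p.asIdeal → q < p →
      w p = 0 ∨ w p < w q) (φ : Q →ₗ[A] A) :
    ∃ θ : Q →ₗ[A] A, ∀ p : PrimeSpectrum A, K ≤ p.asIdeal → a ∉ p.asIdeal → w p ≠ 0 →
      ∃ x, (φ + a • θ) x ∉ p.asIdeal := by
  induction K using WellFoundedGT.induction with
  | ind K ih =>
  by_cases hex : ∃ p : PrimeSpectrum A, K ≤ p.asIdeal ∧ a ∉ p.asIdeal
  · obtain ⟨p0, hK0, ha0⟩ := hex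
    obtain ⟨s, hs, l, l', h1, h2⟩ := hQ p0
    have hlt : K < K ⊔ Ideal.span {s} := by
      refine lt_of_le_of_ne le_sup_left fun e => hs (hK0 ?_)
      rw [e]
      exact Submodule.mem_sup_right (Ideal.mem_span_singleton_self s)
    obtain ⟨θ, hθ⟩ := ih _ hlt (fun p hp => hw p (le_sup_left.trans hp))
      (fun q p hq => hmono q p (le_sup_left.trans hq))
    set φ' := φ + a • θ with hφ'
    let f : ℕ → Q := fun i => if h : i < r then l (Pi.single ⟨i, h⟩ 1) else 0
    obtain ⟨c, hc⟩ := chain_avoid K (a * s ^ 2) r w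
      (fun p hp ha => hw p hp (fun h => ha (Ideal.mul_mem_right _ _ h)))
      (fun q p hq ha => hmono q p hq (fun h => ha (Ideal.mul_mem_right _ _ h)))
      (fun i => φ' (f i)) r
    let C : (Fin r → A) →ₗ[A] A := Fintype.linearCombination A (fun i : Fin r => c i)
    refine ⟨θ + s • (C ∘ₗ l'), fun p hK ha hwp => ?_⟩
    have e : φ + a • (θ + s • (C ∘ₗ l')) = φ' + (a * s) • (C ∘ₗ l') := by
      ext x; simp [hφ']; ring
    rw [e]
    by_cases hsp : s ∈ p.asIdeal
    · obtain ⟨x, hx⟩ := hθ p (sup_le hK ((Ideal.span_singleton_le_iff_mem _).mpr hsp)) ha hwp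
      refine ⟨x, fun hcon => hx ?_⟩
      refine (Ideal.add_mem_iff_left _ ?_).mp hcon
      simp only [LinearMap.smul_apply, smul_eq_mul]
      exact Ideal.mul_mem_right _ _ (Ideal.mul_mem_left _ _ hsp)
    · by_contra! hcon
      apply hwp
      have hsq : a * s ^ 2 ∉ p.asIdeal := fun h => by
        rcases p.2.mem_or_mem h with h | h
        · exact ha h
        · exact hsp (p.2.mem_of_pow_mem _ h)
      have := hc p hK hsq (fun i hi => by
        have := hcon (f i)
        convert this using 1
        simp [f, hi, h2, C, Fintype.linearCombination_apply, Pi.single_apply]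
        ring)
      omega
  · push Not at hex
    exact ⟨0, fun p h1 h2 => absurd (hex p h1) h2⟩

lemma locFree_of_rank [Module.Finite A Q] [Module.Projective A Q] {r : ℕ}
    (h : ∀ p : PrimeSpectrum A, Module.rankAtStalk Q p = r) : LocFree A Q r := by
  intro p
  have hfp : Module.FinitePresentation A Q := Module.finitePresentation_of_projective A Q
  let S := p.asIdeal.primeCompl
  let R := Localization.AtPrime p.asIdeal
  let g : Q →ₗ[A] LocalizedModule S Q := LocalizedModule.mkLinearMap S Q
  have hfree : Module.Free R (LocalizedModule S Q) := Module.free_of_flat_of_isLocalRing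
  let b : Module.Basis (Fin r) R (LocalizedModule S Q) := Module.finBasisOfFinrankEq R _ (h p)
  let E : LocalizedModule S Q ≃ₗ[A] (Fin r → R) := b.equivFun.restrictScalars A
  let F : (Fin r → A) →ₗ[A] (Fin r → R) := LinearMap.pi fun i => Algebra.linearMap A R ∘ₗ LinearMap.proj i
  have : IsLocalizedModule S F := IsLocalizedModule.pi S (fun _ : Fin r => Algebra.linearMap A R)
  obtain ⟨l', s1, hl'⟩ := Module.FinitePresentation.exists_lift_of_isLocalizedModule S F
    (E.toLinearMap ∘ₗ g)
  obtain ⟨l, s2, hl⟩ := Module.FinitePresentation.exists_lift_of_isLocalizedModule S g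
    (E.symm.toLinearMap ∘ₗ F)
  have hl'x : ∀ x, F (l' x) = s1.1 • E (g x) := fun x => LinearMap.congr_fun hl' x
  have hlx : ∀ x, g (l x) = s2.1 • E.symm (F x) := fun x => LinearMap.congr_fun hl x
  have H1 : g ∘ₗ (l ∘ₗ l') = g ∘ₗ ((s1.1 * s2.1) • LinearMap.id) := by
    ext x
    simp [hlx, hl'x, smul_smul, mul_comm]
  have H2 : F ∘ₗ (l' ∘ₗ l) = F ∘ₗ ((s1.1 * s2.1) • LinearMap.id) := by
    apply LinearMap.ext
    intro x
    simp only [LinearMap.comp_apply, hlx, hl'x, map_smul, LinearMap.smul_apply, LinearMap.id_apply,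
      LinearEquiv.apply_symm_apply, smul_smul]
  obtain ⟨s3, h3⟩ := Module.Finite.exists_smul_of_comp_eq_of_isLocalizedModule S g _ _ H1
  obtain ⟨s4, h4⟩ := Module.Finite.exists_smul_of_comp_eq_of_isLocalizedModule S F _ _ H2
  have h3x : ∀ x, s3.1 • l (l' x) = s3.1 • (s1.1 * s2.1) • x := fun x => LinearMap.congr_fun h3 x
  have h4x : ∀ x, s4.1 • l' (l x) = s4.1 • (s1.1 * s2.1) • x := fun x => LinearMap.congr_fun h4 x
  refine ⟨(s4 * s3 * (s1 * s2) : S).1, (s4 * s3 * (s1 * s2) : S).2, (s3.1 * s4.1) • l, l', ?_, ?_⟩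
  · intro x
    rw [LinearMap.smul_apply, mul_comm, mul_smul, h3x, smul_smul, smul_smul]
    rfl
  · intro x
    rw [LinearMap.smul_apply, map_smul, mul_smul, h4x, smul_smul, smul_smul]
    congr 1
    simp only [Submonoid.coe_mul]
    ring

lemma height_bound [IsNoetherianRing A] {r : ℕ} (hQ : LocFree A Q r) (φ : Q →ₗ[A] A) (a : A)
    (h : LinearMap.range φ ⊔ Ideal.span {a} ≠ ⊤) :
    ∃ p : PrimeSpectrum A, LinearMap.range φ ⊔ Ideal.span {a} ≤ p.asIdeal ∧
      Order.height p ≤ ((r + 1 : ℕ) : ℕ∞) := by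
  classical
  obtain ⟨p, hp⟩ := Ideal.nonempty_minimalPrimes h
  let p' : PrimeSpectrum A := ⟨p, hp.1.1⟩
  refine ⟨p', hp.1.2, ?_⟩
  obtain ⟨s, hs, l, l', h1, h2⟩ := hQ p'
  let T : Finset A := insert a (Finset.univ.image fun i : Fin r => φ (l (Pi.single i 1)))
  have hT : T.card ≤ r + 1 := by
    refine (Finset.card_insert_le _ _).trans ?_
    have := Finset.card_image_le (s := Finset.univ) (f := fun i : Fin r => φ (l (Pi.single i 1)))
    simp at this
    omega
  have hmin : p ∈ (Ideal.span (T : Set A)).minimalPrimes := by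
    refine ⟨⟨hp.1.1, ?_⟩, ?_⟩
    · refine le_trans (Ideal.span_le.mpr ?_) hp.1.2
      intro z hz
      simp only [T, Finset.coe_insert, Finset.coe_image, Finset.coe_univ, Set.image_univ] at hz
      rcases hz with rfl | ⟨i, rfl⟩
      · exact Submodule.mem_sup_right (Ideal.mem_span_singleton_self _)
      · exact Submodule.mem_sup_left ⟨_, rfl⟩
    · rintro q ⟨hq, hTq⟩ hqp
      apply hp.2 _ hqp
      refine ⟨hq, sup_le ?_ ?_⟩
      · rintro _ ⟨x, rfl⟩
        have hsx : s * φ x ∈ q := by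
          have : s * φ x = φ (l (l' x)) := by rw [h1]; simp
          rw [this, LinearMap.pi_apply_eq_sum_univ l (l' x), map_sum]
          refine Ideal.sum_mem _ fun i _ => ?_
          rw [map_smul]
          refine Ideal.mul_mem_left _ _ (hTq (Ideal.subset_span ?_))
          simp only [T, Finset.coe_insert, Finset.coe_image, Finset.coe_univ, Set.image_univ]
          right
          refine ⟨i, ?_⟩
          simp only
          congr 2
          ext j
          simp [Pi.single_apply, eq_comm]
        exact (hq.mem_or_mem hsx).resolve_left fun h => hs (hqp h)
      · rw [Ideal.span_singleton_le_iff_mem]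
        exact hTq (Ideal.subset_span (by simp [T]))
  have := Ideal.height_le_card_of_mem_minimalPrimes_span_finset hmin
  rw [← PrimeSpectrum.height_eq_orderHeight]
  exact this.trans (by exact_mod_cast hT)

lemma cd_le_of_le {J : Ideal A} {n : ℕ} (hdim : ringKrullDim (A ⧸ J) + 2 ≤ (n : WithBot ℕ∞))
    (p : PrimeSpectrum A) (hp : J ≤ p.asIdeal) (c : ℕ) (hc : Order.coheight p = c) :
    c + 2 ≤ n := by
  have h1 : ((Order.coheight p : ℕ∞) : WithBot ℕ∞) ≤ ringKrullDim (A ⧸ J) := by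
    rw [ringKrullDim_quotient, Order.coheight_eq_krullDim_Ici]
    refine Order.krullDim_le_of_strictMono
      (fun q : Set.Ici p => (⟨q.1, ?_⟩ : PrimeSpectrum.zeroLocus (J : Set A))) ?_
    · exact hp.trans q.2
    · intro q q' h
      exact h
  rw [hc] at h1
  have h2 := (add_le_add_left h1 2).trans hdim
  have h3 : (((c + 2 : ℕ) : ℕ∞) : WithBot ℕ∞) ≤ ((n : ℕ∞) : WithBot ℕ∞) := h2
  exact_mod_cast WithBot.coe_le_coe.mp h3

end SubtractionAux

open SubtractionAux in
/-- **Subtraction Principle.**  Let `A` be a commutative Noetherian ring, `I, J` comaximal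
ideals, and `P = Q ⊕ A` a finitely generated projective `A`-module of constant rank `n`
with `n ≥ dim (A/J) + 2` and `n + ht I ≥ dim A + 3`.  If `Φ, Ψ : P → A` are linear maps
with `Φ(P) = I`, `Ψ(P) = I ∩ J` and `Φ ≡ Ψ mod I²`, then there is a linear map
`Δ : P → A` with `Δ(P) = J` and `Δ ≡ Ψ mod J²`. -/
theorem subtraction_principle {A : Type*} [CommRing A] [IsNoetherianRing A]
    {Q : Type*} [AddCommGroup Q] [Module A Q]
    [Module.Finite A (Q × A)] [Module.Projective A (Q × A)]
    (n : ℕ) (hrank : ∀ p : PrimeSpectrum A, Module.rankAtStalk (Q × A) p = n)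
    (I J : Ideal A) (hcomax : I ⊔ J = ⊤)
    (hdim : ringKrullDim (A ⧸ J) + 2 ≤ (n : WithBot ℕ∞))
    (hht : ringKrullDim A + 3 ≤ (n : WithBot ℕ∞) + ((idealHeight I : ℕ∞) : WithBot ℕ∞))
    (Φ Ψ : (Q × A) →ₗ[A] A)
    (hΦ : LinearMap.range Φ = I)
    (hΨ : LinearMap.range Ψ = I ⊓ J)
    (hcong : ∀ p : Q × A, Φ p - Ψ p ∈ I ^ 2) :
    ∃ Δ : (Q × A) →ₗ[A] A,
      LinearMap.range Δ = J ∧ ∀ p : Q × A, Δ p - Ψ p ∈ J ^ 2 := by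
  classical
  by_cases hItop : I = ⊤
  · refine ⟨Ψ, ?_, fun p => by simp⟩
    rw [hΨ, hItop, top_inf_eq]
  have hnt : Nontrivial A := by
    by_contra h
    rw [not_nontrivial_iff_subsingleton] at h
    exact hItop (Subsingleton.elim _ _)
  have hprojQ : Module.Projective A Q :=
    Module.Projective.of_split (LinearMap.inl A Q A) (LinearMap.fst A Q A) (by ext x; simp)
  have hfinQ : Module.Finite A Q :=
    Module.Finite.of_surjective (LinearMap.fst A Q A) (fun x => ⟨(x, 0), rfl⟩)
  have hrk : ∀ p : PrimeSpectrum A, Module.rankAtStalk Q p + 1 = n := by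
    intro p
    have := hrank p
    rw [Module.rankAtStalk_prod] at this
    simpa [Module.rankAtStalk_self] using this
  obtain ⟨r, rfl⟩ : ∃ r, n = r + 1 :=
    ⟨_, (hrk (Classical.arbitrary (PrimeSpectrum A))).symm⟩
  have hQ : LocFree A Q r := locFree_of_rank (fun p => by have := hrk p; omega)
  -- components
  obtain ⟨φ, hφ⟩ : ∃ φ : Q →ₗ[A] A, φ = Φ ∘ₗ LinearMap.inl A Q A := ⟨_, rfl⟩
  obtain ⟨ψ, hψ⟩ : ∃ ψ : Q →ₗ[A] A, ψ = Ψ ∘ₗ LinearMap.inl A Q A := ⟨_, rfl⟩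
  obtain ⟨a, ha⟩ : ∃ a, a = Φ (0, 1) := ⟨_, rfl⟩
  obtain ⟨b, hb⟩ : ∃ b, b = Ψ (0, 1) := ⟨_, rfl⟩
  have hdec : ∀ (x : Q) (y : A), (x, y) = (x, (0 : A)) + y • ((0 : Q), (1 : A)) := by
    intro x y; simp
  have hΦd : ∀ x y, Φ (x, y) = φ x + y * a := by
    intro x y
    rw [hdec, map_add, map_smul, hφ, ha]; rfl
  have hΨd : ∀ x y, Ψ (x, y) = ψ x + y * b := by
    intro x y
    rw [hdec, map_add, map_smul, hψ, hb]; rfl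
  have hI0 : LinearMap.range φ ⊔ Ideal.span {a} = I := by
    rw [← hΦ]
    ext z
    rw [mem_rs]
    constructor
    · rintro ⟨x, y, rfl⟩
      exact ⟨(x, y), hΦd x y⟩
    · rintro ⟨⟨x, y⟩, rfl⟩
      exact ⟨x, y, hΦd x y⟩
  have hIJ0 : LinearMap.range ψ ⊔ Ideal.span {b} = I ⊓ J := by
    rw [← hΨ]
    ext z
    rw [mem_rs]
    constructor
    · rintro ⟨x, y, rfl⟩
      exact ⟨(x, y), hΨd x y⟩
    · rintro ⟨⟨x, y⟩, rfl⟩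
      exact ⟨x, y, hΨd x y⟩
  have hc1 : ∀ x, ψ x - φ x ∈ I ^ 2 := fun x => by
    have := neg_mem (hcong (x, 0))
    simpa [hΦd, hΨd] using this
  have hc2 : b - a ∈ I ^ 2 := by
    have := neg_mem (hcong (0, 1))
    simpa [hΦd, hΨd] using this
  -- it suffices to treat the components
  suffices hgood : Good J ψ b by
    obtain ⟨δ, d, h1, h2, h3⟩ := hgood
    refine ⟨δ.coprod (LinearMap.toSpanSingleton A A d), ?_, ?_⟩
    · rw [← h1]
      ext z
      rw [mem_rs]
      constructor
      · rintro ⟨⟨x, y⟩, rfl⟩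
        exact ⟨x, y, by simp⟩
      · rintro ⟨x, y, rfl⟩
        exact ⟨(x, y), by simp⟩
    · rintro ⟨x, y⟩
      have := add_mem (h2 x) (Ideal.mul_mem_left _ y h3)
      convert this using 1
      simp [hΨd]
      ring
  -- numerical facts
  obtain ⟨p0, hp0, hp0h⟩ := height_bound hQ φ a (by rw [hI0]; exact hItop)
  rw [hI0] at hp0
  have hHle : idealHeight I ≤ ((r + 1 : ℕ) : ℕ∞) := (iInf₂_le p0 hp0).trans hp0h
  obtain ⟨H, hH⟩ := ENat.ne_top_iff_exists.mp (ne_top_of_le_ne_top (ENat.natCast_ne_top _) hHle)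
  rw [← hH] at hHle hht
  have hHr : H ≤ r + 1 := by exact_mod_cast hHle
  have hsup : ringKrullDim A = ((⨆ p : PrimeSpectrum A, Order.height p + Order.coheight p : ℕ∞) :
      WithBot ℕ∞) := Order.krullDim_eq_iSup_height_add_coheight_of_nonempty
  obtain ⟨S, hS⟩ : ∃ S : ℕ∞, S = ⨆ p : PrimeSpectrum A, Order.height p + Order.coheight p :=
    ⟨_, rfl⟩
  rw [← hS] at hsup
  rw [hsup] at hht
  have hht' : S + 3 ≤ ((r + 1 : ℕ) : ℕ∞) + (H : ℕ∞) :=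
    WithBot.coe_le_coe.mp hht
  have hSfin : S ≠ ⊤ := by
    rintro rfl
    rw [top_add, top_le_iff] at hht'
    exact absurd hht' (by exact_mod_cast ENat.natCast_ne_top (r + 1 + H))
  obtain ⟨D, rfl⟩ := ENat.ne_top_iff_exists.mp hSfin
  have hD : D + 3 ≤ (r + 1) + H := by exact_mod_cast hht'
  have hhc : ∀ p : PrimeSpectrum A, Order.height p + Order.coheight p ≤ (D : ℕ∞) := fun p => by
    rw [hS]; exact le_iSup (fun p : PrimeSpectrum A => Order.height p + Order.coheight p) p
  have hex : ∀ p : PrimeSpectrum A, ∃ c : ℕ, Order.coheight p = c := fun p => by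
    obtain ⟨c, hc⟩ := ENat.ne_top_iff_exists.mp
      (ne_top_of_le_ne_top (ENat.natCast_ne_top D) (le_add_self.trans (hhc p)))
    exact ⟨c, hc.symm⟩
  choose cd hcd using hex
  have hcdD : ∀ p, cd p ≤ D := fun p => by
    have := le_add_self.trans (hhc p)
    rw [hcd] at this
    exact_mod_cast this
  have hcdlt : ∀ q p : PrimeSpectrum A, q < p → cd p < cd q := fun q p h => by
    have := Order.coheight_strictAnti h (by rw [hcd]; exact ENat.natCast_lt_top _)
    rw [hcd, hcd] at this
    exact_mod_cast this
  have hcdI : ∀ p : PrimeSpectrum A, I ≤ p.asIdeal → cd p + H ≤ D := fun p hp => by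
    have h1 : (H : ℕ∞) ≤ Order.height p := by
      rw [hH]
      exact iInf₂_le p hp
    have h2 := (add_le_add_left h1 (Order.coheight p)).trans (hhc p)
    rw [hcd] at h2
    have : H + cd p ≤ D := by exact_mod_cast h2
    omega
  have hcdJ : ∀ p : PrimeSpectrum A, J ≤ p.asIdeal → cd p + 1 ≤ r := fun p hp => by
    have := cd_le_of_le hdim p hp _ (hcd p)
    omega
  -- first general position step
  obtain ⟨θ1, hθ1⟩ := gp hQ a (fun p => cd p + 1) J (fun p hp _ => hcdJ p hp)
    (fun q p _ _ h => Or.inr (Nat.succ_lt_succ (hcdlt q p h))) φ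
  obtain ⟨φ1, hφ1⟩ : ∃ φ1, φ1 = φ + a • θ1 := ⟨_, rfl⟩
  rw [← hφ1] at hθ1
  have hI1 : LinearMap.range φ1 ⊔ Ideal.span {a} = I := by rw [hφ1, rs_add, hI0]
  have hLJ1 : LinearMap.range φ1 ⊔ J = ⊤ := by
    by_contra hne
    obtain ⟨m, hm, hle⟩ := Ideal.exists_le_maximal _ hne
    have hJm : J ≤ m := le_sup_right.trans hle
    have hφm : LinearMap.range φ1 ≤ m := le_sup_left.trans hle
    by_cases ham : a ∈ m
    · apply hm.ne_top
      rw [eq_top_iff, ← hcomax, ← hI1]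
      exact sup_le (sup_le hφm ((Ideal.span_singleton_le_iff_mem _).mpr ham)) hJm
    · obtain ⟨x, hx⟩ := hθ1 ⟨m, hm.isPrime⟩ hJm ham (Nat.succ_ne_zero _)
      exact hx (hφm ⟨x, rfl⟩)
  obtain ⟨x1, j, hj, hx1⟩ : ∃ x1 : Q, ∃ j ∈ J, φ1 x1 + j = 1 := by
    have h1 : (1 : A) ∈ LinearMap.range φ1 ⊔ J := hLJ1 ▸ Submodule.mem_top
    obtain ⟨_, ⟨q, rfl⟩, l, hl, e⟩ := Submodule.mem_sup.mp h1
    exact ⟨q, l, hl, e⟩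
  -- second general position step
  obtain ⟨θ2, hθ2⟩ := gp hQ (a * j) (fun p => cd p - (r - 1)) ⊥
    (fun p _ _ => by have := hcdD p; omega)
    (fun q p _ _ h => by have := hcdlt q p h; omega) φ1
  obtain ⟨φ2, hφ2⟩ : ∃ φ2, φ2 = φ1 + a • (j • θ2) := ⟨_, rfl⟩
  have hφ2' : φ1 + (a * j) • θ2 = φ2 := by rw [hφ2, mul_smul]
  rw [hφ2'] at hθ2
  have hφ2x : ∀ x, φ2 x = φ1 x + a * (j * θ2 x) := fun x => by rw [hφ2]; simp
  obtain ⟨L, hL⟩ : ∃ L : Ideal A, LinearMap.range φ2 = L := ⟨_, rfl⟩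
  have hφL : ∀ x, φ2 x ∈ L := fun x => hL.le ⟨x, rfl⟩
  have hI2 : L ⊔ Ideal.span {a} = I := by rw [← hL, hφ2, rs_add, hI1]
  have hLJ2 : L ⊔ J = ⊤ := by
    rw [Ideal.eq_top_iff_one]
    refine Submodule.mem_sup.mpr ⟨φ2 x1, hφL x1, j * (1 - a * θ2 x1),
      Ideal.mul_mem_right _ _ hj, ?_⟩
    rw [hφ2x]
    linear_combination hx1
  have hcdL : ∀ p : PrimeSpectrum A, L ≤ p.asIdeal → cd p + 1 ≤ r := by
    intro p hp
    by_cases haj : a * j ∈ p.asIdeal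
    · rcases p.2.mem_or_mem haj with h | h
      · have := hcdI p (by
          rw [← hI2]; exact sup_le hp ((Ideal.span_singleton_le_iff_mem _).mpr h))
        omega
      · exfalso
        apply p.2.ne_top
        rw [Ideal.eq_top_iff_one]
        have := add_mem (hp (hφL x1)) (Ideal.mul_mem_right (1 - a * θ2 x1) _ h)
        convert this using 1
        rw [hφ2x]
        linear_combination -hx1
    · by_contra hlt
      obtain ⟨x, hx⟩ := hθ2 p bot_le haj (by omega)
      exact hx (hp (hφL x))
  -- conclude
  have hg : Good J ((ψ + b • θ1) + b • (j • θ2)) b := by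
    refine good_core hL hI2 hLJ2 ?_ hc2 ?_ ?_
    · intro x
      have := add_mem (hc1 x) (Ideal.mul_mem_right (θ1 x + j * θ2 x) _ hc2)
      convert this using 1
      rw [hφ2x, hφ1]
      simp
      ring
    · rw [rs_add, rs_add, hIJ0]
    · intro η f hf
      obtain ⟨χ, hχ⟩ := gp hQ f (fun p => cd p + 1) L (fun p hp _ => hcdL p hp)
        (fun q p _ _ h => Or.inr (Nat.succ_lt_succ (hcdlt q p h))) η
      refine ⟨χ, fun p hp => ?_⟩
      by_cases hfp : f ∈ p.asIdeal
      · obtain ⟨x, hx⟩ := hf p hp hfp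
        refine ⟨x, fun hcon => hx ?_⟩
        exact (Ideal.add_mem_iff_left _ (Ideal.mul_mem_right _ _ hfp)).mp hcon
      · exact hχ p hp hfp (Nat.succ_ne_zero _)
  exact hg.of_add.of_add
end
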